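/- Let ρ₀ be a smooth density on the torus [0,R)^d with mean n ≥ 1/2, p ≥ 1, and let φ solve −Δφ = ρ₀ − n. Then W_p^p(ρ₀, n) ≤ 2^{p−1} p^p ∫_{[0,R)^d} |∇φ|^p, where W_p is the p-Wasserstein distance on the torus. -/

import Mathlib

open MeasureTheory

/-- The fundamental domain `[0, R)^d` of the torus. -/
def torusCube (d : ℕ) (R : ℝ) : Set (EuclideanSpace ℝ (Fin d)) :=
  {x | ∀ i, x i ∈ Set.Ico 0 R}

/-- The periodic distance on the torus `[0,R)^d`. -/
noncomputable def pdist (d : ℕ) (R : ℝ) (x y : EuclideanSpace ℝ (Fin d)) : ℝ :=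
  ⨅ k : Fin d → ℤ, ‖x - y - (EuclideanSpace.equiv (Fin d) ℝ).symm (fun i => R * (k i : ℝ))‖

/-- `p`-th power of the `p`-Wasserstein distance on the torus `[0,R)^d`. -/
noncomputable def WpTorusPow (d : ℕ) (R p : ℝ)
    (μ ν : Measure (EuclideanSpace ℝ (Fin d))) : ℝ :=
  sInf {c : ℝ | ∃ π : Measure (EuclideanSpace ℝ (Fin d) × EuclideanSpace ℝ (Fin d)),
    π.fst = μ ∧ π.snd = ν ∧ c = ∫ q, pdist d R q.1 q.2 ^ p ∂π}

/-- Divergence of a vector field on `ℝ^d`. -/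
noncomputable def divergence (d : ℕ)
    (f : EuclideanSpace ℝ (Fin d) → EuclideanSpace ℝ (Fin d))
    (x : EuclideanSpace ℝ (Fin d)) : ℝ :=
  ∑ i, fderiv ℝ f x (EuclideanSpace.single i 1) i

/-- Laplacian of a scalar function on `ℝ^d`. -/
noncomputable def lap (d : ℕ) (φ : EuclideanSpace ℝ (Fin d) → ℝ)
    (x : EuclideanSpace ℝ (Fin d)) : ℝ :=
  divergence d (gradient φ) x

theorem contDiffAt_fderiv_snd {E : Type*} [NormedAddCommGroup E] [NormedSpace ℝ E]
    {w : ℝ → E → E} {z : ℝ × E}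
    (hw : ContDiffAt ℝ 2 (Function.uncurry w) z) :
    ContDiffAt ℝ 1 (fun z : ℝ × E => fderiv ℝ (w z.1) z.2) z := by
  refine ContDiffAt.fderiv (f := fun (z : ℝ × E) (y : E) => w z.1 y) (g := Prod.snd)
    (m := 1) (n := 2) ?_ contDiffAt_snd (by norm_num)
  exact ContDiffAt.comp (z, z.2) (g := Function.uncurry w)
    (f := fun q : (ℝ × E) × E => (q.1.1, q.2)) hw (by fun_prop)

section Calculus

variable {E : Type*} [NormedAddCommGroup E] [NormedSpace ℝ E] [FiniteDimensional ℝ E]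

/-- The determinant of a continuous endomorphism is a smooth function. -/
theorem contDiff_clm_det {m : WithTop ℕ∞} : ContDiff ℝ m (fun f : E →L[ℝ] E => f.det) := by
  let b := Module.finBasis ℝ E
  have h : (fun f : E →L[ℝ] E => f.det) =
      fun f : E →L[ℝ] E => (LinearMap.toMatrix b b (f : E →ₗ[ℝ] E)).det := by
    ext f
    rw [LinearMap.det_toMatrix]
  rw [h]
  simp only [Matrix.det_apply]
  refine ContDiff.sum fun σ _ => ContDiff.const_smul _ (contDiff_prod fun i _ => ?_)
  let l : (E →L[ℝ] E) →ₗ[ℝ] ℝ :=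
    { toFun := fun f => LinearMap.toMatrix b b (f : E →ₗ[ℝ] E) (σ i) i
      map_add' := fun f g => by simp
      map_smul' := fun c f => by simp }
  exact (LinearMap.toContinuousLinearMap l).contDiff

theorem hasDerivAt_det_one_add_smul (M : E →L[ℝ] E) :
    HasDerivAt (fun h : ℝ => (1 + h • M).det) (LinearMap.trace ℝ E M) 0 := by
  let b := Module.finBasis ℝ E
  let A := LinearMap.toMatrix b b (M : E →ₗ[ℝ] E)
  let P : Polynomial ℝ := (1 + (Polynomial.X : Polynomial ℝ) • A.map Polynomial.C).det
  have h : (fun h : ℝ => (1 + h • M).det) = fun h => P.eval h := by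
    ext h
    have h1 : (1 + h • M).det = (1 + h • A).det := by
      change LinearMap.det ((1 + h • M : E →L[ℝ] E) : E →ₗ[ℝ] E) = _
      rw [← LinearMap.det_toMatrix b]
      congr 1
      have : ((1 + h • M : E →L[ℝ] E) : E →ₗ[ℝ] E) = LinearMap.id + h • (M : E →ₗ[ℝ] E) := rfl
      rw [this, map_add, map_smul, LinearMap.toMatrix_id]
    rw [h1]
    change _ = (Polynomial.evalRingHom h) P
    rw [RingHom.map_det]
    congr 1
    ext i j
    by_cases hij : i = j
    · simp [hij, mul_comm h]
    · simp [hij, mul_comm h]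
  rw [h]
  have := P.hasDerivAt 0
  rwa [Matrix.derivative_det_one_add_X_smul, ← LinearMap.trace_eq_matrix_trace] at this

theorem hasDerivAt_mul_det_one_add_smul {f : ℝ × E → ℝ} {z : ℝ × E} (hf : DifferentiableAt ℝ f z)
    (v : E) (M : E →L[ℝ] E) :
    HasDerivAt (fun h : ℝ => f (z.1 + h, z.2 + h • v) * (1 + h • M).det)
      (fderiv ℝ f z (1, v) + f z * LinearMap.trace ℝ E M) 0 := by
  have hc : HasDerivAt (fun h : ℝ => (z.1 + h, z.2 + h • v)) ((1 : ℝ), v) 0 := by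
    refine ((hasDerivAt_id (0 : ℝ)).const_add _).prodMk ?_
    simpa using ((hasDerivAt_id (0 : ℝ)).smul_const v).const_add z.2
  have hd : HasFDerivAt f (fderiv ℝ f z) (z.1 + 0, z.2 + (0 : ℝ) • v) := by
    simpa using hf.hasFDerivAt
  have h1 : HasDerivAt (fun h : ℝ => f (z.1 + h, z.2 + h • v)) (fderiv ℝ f z (1, v)) 0 :=
    hd.comp_hasDerivAt (0 : ℝ) hc
  have h2 := h1.mul (hasDerivAt_det_one_add_smul M)
  have h3 : (1 : E →L[ℝ] E).det = 1 := LinearMap.det_id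
  simp only [zero_smul, add_zero, h3, mul_one] at h2
  exact h2

/-- An explicit Euler step along a velocity field solving the continuity equation transports the
density up to an error of higher order in the step size, uniformly on compact sets. -/
theorem euler_step_density {ρ : ℝ → E → ℝ} {w : ℝ → E → E} {K : Set (ℝ × E)} (hK : IsCompact K)
    (hρ : ∀ z ∈ K, ContDiffAt ℝ 2 (Function.uncurry ρ) z)
    (hw : ∀ z ∈ K, ContDiffAt ℝ 2 (Function.uncurry w) z)
    (hpos : ∀ z ∈ K, 0 < ρ z.1 z.2)
    (hcont : ∀ z ∈ K, fderiv ℝ (Function.uncurry ρ) z (1, w z.1 z.2)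
      + ρ z.1 z.2 * LinearMap.trace ℝ E (fderiv ℝ (w z.1) z.2) = 0)
    {η : ℝ} (hη : 0 < η) :
    ∃ h₀ > 0, ∀ z ∈ K, ∀ h ∈ Set.Icc 0 h₀,
      ρ z.1 z.2 ≤ (1 + η * h) *
        (ρ (z.1 + h) (z.2 + h • w z.1 z.2) * (1 + h • fderiv ℝ (w z.1) z.2).det) := by
  have key : ∀ z₀ ∈ K, ∃ h₀ > 0, ∀ᶠ z in nhds z₀, ∀ h ∈ Set.Icc 0 h₀,
      ρ z.1 z.2 ≤ (1 + η * h) *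
        (ρ (z.1 + h) (z.2 + h • w z.1 z.2) * (1 + h • fderiv ℝ (w z.1) z.2).det) := by
    intro z₀ hz₀
    let G : (ℝ × E) × ℝ → ℝ := fun q =>
      Function.uncurry ρ (q.1.1 + q.2, q.1.2 + q.2 • Function.uncurry w q.1) *
        (1 + q.2 • fderiv ℝ (w q.1.1) q.1.2).det
    have hw1 : ContDiffAt ℝ 1 (fun q : (ℝ × E) × ℝ => Function.uncurry w q.1) (z₀, 0) :=
      ContDiffAt.comp (z₀, (0 : ℝ)) ((hw z₀ hz₀).of_le (by norm_num)) contDiffAt_fst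
    have hDw : ContDiffAt ℝ 1 (fun q : (ℝ × E) × ℝ => fderiv ℝ (w q.1.1) q.1.2) (z₀, 0) :=
      ContDiffAt.comp (z₀, (0 : ℝ)) (contDiffAt_fderiv_snd (hw z₀ hz₀)) contDiffAt_fst
    have hGs : ContDiffAt ℝ 1 G (z₀, 0) := by
      refine ContDiffAt.mul ?_ ?_
      · refine ContDiffAt.comp (z₀, (0 : ℝ)) (g := Function.uncurry ρ)
          (f := fun q : (ℝ × E) × ℝ => (q.1.1 + q.2, q.1.2 + q.2 • Function.uncurry w q.1)) ?_ ?_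
        · simpa using (hρ z₀ hz₀).of_le (by norm_num)
        · refine ContDiffAt.prodMk (by fun_prop) (ContDiffAt.add (by fun_prop) ?_)
          exact contDiffAt_snd.smul hw1
      · exact ContDiffAt.comp (z₀, (0 : ℝ)) (contDiff_clm_det (E := E)).contDiffAt
          (f := fun q : (ℝ × E) × ℝ => 1 + q.2 • fderiv ℝ (w q.1.1) q.1.2) (by fun_prop)
    have hstrict := hGs.hasStrictFDerivAt (by norm_num)
    have hzero : fderiv ℝ G (z₀, 0) (0, 1) = 0 := by
      have h1 : HasDerivAt (fun h : ℝ => G (z₀, h)) (fderiv ℝ G (z₀, 0) (0, 1)) 0 := by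
        have hc : HasDerivAt (fun h : ℝ => (z₀, h)) ((0 : ℝ × E), (1 : ℝ)) 0 :=
          (hasDerivAt_const _ _).prodMk (hasDerivAt_id _)
        exact hstrict.hasFDerivAt.comp_hasDerivAt (0 : ℝ) hc
      have h2 : HasDerivAt (fun h : ℝ => G (z₀, h))
          (fderiv ℝ (Function.uncurry ρ) z₀ (1, w z₀.1 z₀.2)
            + Function.uncurry ρ z₀ * LinearMap.trace ℝ E (fderiv ℝ (w z₀.1) z₀.2)) 0 :=
        hasDerivAt_mul_det_one_add_smul ((hρ z₀ hz₀).differentiableAt (by norm_num))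
          (w z₀.1 z₀.2) (fderiv ℝ (w z₀.1) z₀.2)
      exact (h1.unique h2).trans (hcont z₀ hz₀)
    set m := ρ z₀.1 z₀.2 / 2 with hm
    have hmpos : 0 < m := half_pos (hpos z₀ hz₀)
    set c := η * m / (1 + η) with hc
    have hcpos : 0 < c := by positivity
    have hlo : ∀ᶠ z in nhds z₀, m < ρ z.1 z.2 := by
      have : ContinuousAt (Function.uncurry ρ) z₀ := (hρ z₀ hz₀).continuousAt
      exact this.eventually (lt_mem_nhds (a := m) (by
        simp only [Function.uncurry, hm]; linarith [hpos z₀ hz₀]))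
    have hev : ∀ᶠ q : ((ℝ × E) × ℝ) in nhds (z₀, 0),
        |G q - G (q.1, 0)| ≤ c * |q.2| := by
      have h1 := hstrict.isLittleO.def hcpos
      have ht : Filter.Tendsto (fun q : (ℝ × E) × ℝ => (q, (q.1, (0 : ℝ)))) (nhds (z₀, 0))
          (nhds ((z₀, 0), (z₀, 0))) := by
        have : Continuous (fun q : (ℝ × E) × ℝ => (q, (q.1, (0 : ℝ)))) := by fun_prop
        exact this.tendsto' _ _ rfl
      filter_upwards [ht.eventually h1] with q hq
      have e1 : q - (q.1, (0 : ℝ)) = q.2 • ((0 : ℝ × E), (1 : ℝ)) := by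
        ext <;> simp
      rw [e1, map_smul, hzero, smul_zero, sub_zero, norm_smul] at hq
      simpa [Prod.norm_def] using hq
    rw [nhds_prod_eq, Filter.eventually_prod_iff] at hev
    obtain ⟨pa, hpa, pb, hpb, hab⟩ := hev
    obtain ⟨r, hr, hrb⟩ := Metric.eventually_nhds_iff.1 hpb
    refine ⟨min (r / 2) 1, by positivity, ?_⟩
    filter_upwards [hpa, hlo] with z hz hzlo h hh
    have hh1 : h ≤ 1 := hh.2.trans (min_le_right _ _)
    have hhr : h < r := lt_of_le_of_lt (hh.2.trans (min_le_left _ _)) (by linarith)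
    have hq := hab hz (hrb (y := h) (by simpa [abs_of_nonneg hh.1] using hhr))
    have hG0 : G (z, 0) = ρ z.1 z.2 := by
      have : (1 : E →L[ℝ] E).det = 1 := LinearMap.det_id
      simp [G, Function.uncurry, this]
    rw [hG0, abs_of_nonneg hh.1] at hq
    change _ ≤ (1 + η * h) * G (z, h)
    have h3 := (abs_le.1 hq).1
    have hcm : c * (1 + η) = η * m := by rw [hc]; field_simp
    have h4 : (1 + η * h) * (ρ z.1 z.2 - c * h) ≤ (1 + η * h) * G (z, h) :=
      mul_le_mul_of_nonneg_left (by linarith) (by have := mul_nonneg hη.le hh.1; linarith)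
    have h5 : 0 ≤ h * (η * (ρ z.1 z.2 - m)) :=
      mul_nonneg hh.1 (mul_nonneg hη.le (by linarith))
    have h6 : 0 ≤ h * (c * η * (1 - h)) :=
      mul_nonneg hh.1 (mul_nonneg (by positivity) (by linarith))
    nlinarith [congrArg (fun t => h * t) hcm]
  refine hK.induction_on (p := fun s => ∃ h₀ > 0, ∀ z ∈ s, ∀ h ∈ Set.Icc 0 h₀,
      ρ z.1 z.2 ≤ (1 + η * h) *
        (ρ (z.1 + h) (z.2 + h • w z.1 z.2) * (1 + h • fderiv ℝ (w z.1) z.2).det)) ?_ ?_ ?_ ?_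
  · exact ⟨1, one_pos, by simp⟩
  · rintro s t hst ⟨h₀, hh₀, h⟩
    exact ⟨h₀, hh₀, fun z hz => h z (hst hz)⟩
  · rintro s t ⟨a, ha, h1⟩ ⟨b, hb, h2⟩
    refine ⟨min a b, lt_min ha hb, ?_⟩
    rintro z (hz | hz) h hh
    · exact h1 z hz h ⟨hh.1, hh.2.trans (min_le_left _ _)⟩
    · exact h2 z hz h ⟨hh.1, hh.2.trans (min_le_right _ _)⟩
  · intro z hz
    obtain ⟨h₀, hh₀, h⟩ := key z hz
    exact ⟨_, mem_nhdsWithin_of_mem_nhds h, h₀, hh₀, fun z hz => hz⟩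

end Calculus

/-- The linear interpolation from `ρ₀` at time `0` to the constant `n` at time `1`. -/
noncomputable def moserDensity (d : ℕ) (n : ℝ) (ρ₀ : EuclideanSpace ℝ (Fin d) → ℝ) (s : ℝ)
    (x : EuclideanSpace ℝ (Fin d)) : ℝ :=
  s * n + (1 - s) * ρ₀ x

/-- The velocity field transporting `moserDensity`. -/
noncomputable def moserVelocity (d : ℕ) (n : ℝ) (ρ₀ φ : EuclideanSpace ℝ (Fin d) → ℝ) (s : ℝ)
    (x : EuclideanSpace ℝ (Fin d)) : EuclideanSpace ℝ (Fin d) :=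
  -(moserDensity d n ρ₀ s x)⁻¹ • gradient φ x

section Moser

variable {d : ℕ} {n : ℝ} {ρ₀ φ : EuclideanSpace ℝ (Fin d) → ℝ}

theorem divergence_eq_trace (f : EuclideanSpace ℝ (Fin d) → EuclideanSpace ℝ (Fin d))
    (x : EuclideanSpace ℝ (Fin d)) :
    divergence d f x = LinearMap.trace ℝ (EuclideanSpace ℝ (Fin d)) (fderiv ℝ f x) := by
  rw [LinearMap.trace_eq_sum_inner _ (EuclideanSpace.basisFun (Fin d) ℝ)]
  simp [divergence, EuclideanSpace.inner_single_left]

theorem contDiff_gradient (hφ : ContDiff ℝ (⊤ : ℕ∞) φ) : ContDiff ℝ 2 (gradient φ) := by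
  have h : ContDiff ℝ 2 (fderiv ℝ φ) :=
    hφ.fderiv_right (WithTop.coe_le_coe.2 le_top)
  exact (InnerProductSpace.toDual ℝ (EuclideanSpace ℝ (Fin d))).symm.contDiff.comp h

theorem contDiff_moserDensity (hρ₀ : ContDiff ℝ (⊤ : ℕ∞) ρ₀) :
    ContDiff ℝ 2 (Function.uncurry (moserDensity d n ρ₀)) := by
  have h : ContDiff ℝ 2 ρ₀ := hρ₀.of_le (WithTop.coe_le_coe.2 le_top)
  change ContDiff ℝ 2 fun z : ℝ × EuclideanSpace ℝ (Fin d) => z.1 * n + (1 - z.1) * ρ₀ z.2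
  fun_prop

theorem contDiffAt_moserVelocity (hρ₀ : ContDiff ℝ (⊤ : ℕ∞) ρ₀) (hφ : ContDiff ℝ (⊤ : ℕ∞) φ)
    {z : ℝ × EuclideanSpace ℝ (Fin d)} (hz : 0 < moserDensity d n ρ₀ z.1 z.2) :
    ContDiffAt ℝ 2 (Function.uncurry (moserVelocity d n ρ₀ φ)) z := by
  have h1 := (contDiff_moserDensity (n := n) hρ₀).contDiffAt (x := z)
  have h2 : ContDiff ℝ 2 fun z : ℝ × EuclideanSpace ℝ (Fin d) => gradient φ z.2 :=
    (contDiff_gradient hφ).comp contDiff_snd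
  exact (h1.inv hz.ne').neg.smul h2.contDiffAt

theorem moserDensity_continuity_equation (hρ₀ : ContDiff ℝ (⊤ : ℕ∞) ρ₀)
    (hφ : ContDiff ℝ (⊤ : ℕ∞) φ) (hPDE : ∀ x, -(lap d φ x) = ρ₀ x - n)
    {z : ℝ × EuclideanSpace ℝ (Fin d)} (hz : 0 < moserDensity d n ρ₀ z.1 z.2) :
    fderiv ℝ (Function.uncurry (moserDensity d n ρ₀)) z (1, moserVelocity d n ρ₀ φ z.1 z.2)
      + moserDensity d n ρ₀ z.1 z.2
        * LinearMap.trace ℝ (EuclideanSpace ℝ (Fin d)) (fderiv ℝ (moserVelocity d n ρ₀ φ z.1) z.2) = 0 := by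
  obtain ⟨s, x⟩ := z
  simp only at hz ⊢
  have hρ : HasFDerivAt ρ₀ (fderiv ℝ ρ₀ x) x :=
    (hρ₀.differentiable (by simp)).differentiableAt.hasFDerivAt
  have hg : HasFDerivAt (gradient φ) (fderiv ℝ (gradient φ) x) x :=
    ((contDiff_gradient hφ).differentiable (by simp)).differentiableAt.hasFDerivAt
  have hdens : HasFDerivAt (moserDensity d n ρ₀ s) ((1 - s) • fderiv ℝ ρ₀ x) x :=
    (hρ.const_mul (1 - s)).const_add (s * n)
  have h1 : ∀ v, fderiv ℝ (Function.uncurry (moserDensity d n ρ₀)) (s, x) (1, v)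
      = (n - ρ₀ x) + (1 - s) * fderiv ℝ ρ₀ x v := by
    intro v
    have hs : HasFDerivAt (fun z : ℝ × EuclideanSpace ℝ (Fin d) => z.1)
        (ContinuousLinearMap.fst ℝ ℝ _) (s, x) := hasFDerivAt_fst
    have hr : HasFDerivAt (fun z : ℝ × EuclideanSpace ℝ (Fin d) => ρ₀ z.2)
        ((fderiv ℝ ρ₀ x).comp (ContinuousLinearMap.snd ℝ ℝ _)) (s, x) :=
      HasFDerivAt.comp (s, x) hρ hasFDerivAt_snd
    have := (hs.mul_const n).add ((hs.const_sub 1).mul hr)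
    have h2 : HasFDerivAt (Function.uncurry (moserDensity d n ρ₀)) _ (s, x) := this
    rw [h2.fderiv]
    simp
    ring
  have htr : LinearMap.trace ℝ (EuclideanSpace ℝ (Fin d)) (fderiv ℝ (moserVelocity d n ρ₀ φ s) x)
      = -(moserDensity d n ρ₀ s x)⁻¹ * lap d φ x
        + (moserDensity d n ρ₀ s x ^ 2)⁻¹ * ((1 - s) * fderiv ℝ ρ₀ x (gradient φ x)) := by
    have h3 := ((hasDerivAt_inv hz.ne').comp_hasFDerivAt x hdens).neg.smul hg
    have h4 : HasFDerivAt (moserVelocity d n ρ₀ φ s) _ x := h3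
    rw [h4.fderiv, lap, divergence_eq_trace]
    simp [LinearMap.trace_smulRight]
  have hl : lap d φ x = n - ρ₀ x := by linarith [hPDE x]
  rw [h1, htr, hl]
  simp only [moserVelocity, map_smul, smul_eq_mul]
  field_simp
  ring

end Moser

section Transport

variable {E : Type*} [NormedAddCommGroup E] [NormedSpace ℝ E] [FiniteDimensional ℝ E]
  [MeasurableSpace E] [BorelSpace E]

/-- An injective differentiable map pushes a density `f` below `c • g` as soon as the
corresponding Jacobian inequality holds pointwise. -/
theorem map_withDensity_le {μ : Measure E} [μ.IsAddHaarMeasure] {F : E → E} (hF : Differentiable ℝ F)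
    (hinj : Function.Injective F) {f g : E → ENNReal} {c : ENNReal} (hc : c ≠ ⊤)
    (h : ∀ x, f x ≤ c * (ENNReal.ofReal |(fderiv ℝ F x).det| * g (F x))) :
    (μ.withDensity f).map F ≤ c • μ.withDensity g := by
  refine Measure.le_iff.2 fun A hA => ?_
  have hFA : MeasurableSet (F ⁻¹' A) := hF.continuous.measurable hA
  rw [Measure.map_apply hF.continuous.measurable hA, withDensity_apply _ hFA, Measure.smul_apply,
    withDensity_apply _ hA, smul_eq_mul]
  calc ∫⁻ x in F ⁻¹' A, f x ∂μ
      ≤ ∫⁻ x in F ⁻¹' A, c * (ENNReal.ofReal |(fderiv ℝ F x).det| * g (F x)) ∂μ :=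
        lintegral_mono h
    _ = c * ∫⁻ x in F ⁻¹' A, ENNReal.ofReal |(fderiv ℝ F x).det| * g (F x) ∂μ :=
        lintegral_const_mul' _ _ hc
    _ = c * ∫⁻ x in F '' (F ⁻¹' A), g x ∂μ := by
        rw [lintegral_image_eq_lintegral_abs_det_fderiv_mul μ hFA
          (fun x _ => (hF x).hasFDerivAt.hasFDerivWithinAt) hinj.injOn]
    _ ≤ c * ∫⁻ x in A, g x ∂μ := by
        gcongr
        exact Set.image_preimage_subset F A

end Transport

/-- The vector `R k` of the lattice `R ℤ^d`. -/
noncomputable def latticeVec (d : ℕ) (R : ℝ) (k : Fin d → ℤ) : EuclideanSpace ℝ (Fin d) :=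
  (EuclideanSpace.equiv (Fin d) ℝ).symm (fun i => R * (k i : ℝ))

/-- The index of the lattice cell containing a point. -/
noncomputable def latticeIndex (d : ℕ) (R : ℝ) (x : EuclideanSpace ℝ (Fin d)) : Fin d → ℤ :=
  fun i => ⌊x i / R⌋

/-- The representative of a point in the fundamental domain. -/
noncomputable def torusRep (d : ℕ) (R : ℝ) (x : EuclideanSpace ℝ (Fin d)) :
    EuclideanSpace ℝ (Fin d) :=
  x - latticeVec d R (latticeIndex d R x)

section Torus

variable {d : ℕ} {R : ℝ}

@[simp]
theorem latticeVec_apply (k : Fin d → ℤ) (i : Fin d) : latticeVec d R k i = R * (k i : ℝ) := rfl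

theorem apply_add_latticeVec {α : Type*} {f : EuclideanSpace ℝ (Fin d) → α}
    (hf : ∀ x i, f (x + R • EuclideanSpace.single i 1) = f x) (k : Fin d → ℤ)
    (x : EuclideanSpace ℝ (Fin d)) : f (x + latticeVec d R k) = f x := by
  have h1 : latticeVec d R k = ∑ i, k i • (R • EuclideanSpace.single i (1 : ℝ)) := by
    ext j
    simp [Pi.single_apply, mul_comm]
  have h2 : ∀ s : Finset (Fin d),
      Function.Periodic f (∑ i ∈ s, k i • (R • EuclideanSpace.single i (1 : ℝ))) := by
    intro s
    induction s using Finset.cons_induction with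
    | empty => intro x; simp
    | cons a s ha ih =>
      rw [Finset.sum_cons]
      have h3 : Function.Periodic f (R • EuclideanSpace.single a (1 : ℝ)) := fun x => hf x a
      exact (h3.zsmul (k a)).add_period ih
  rw [h1]
  exact h2 _ x

theorem torusRep_mem (hR : 0 < R) (x : EuclideanSpace ℝ (Fin d)) :
    torusRep d R x ∈ torusCube d R := by
  intro i
  have h1 := Int.floor_le (x i / R)
  have h2 := Int.lt_floor_add_one (x i / R)
  rw [le_div_iff₀ hR] at h1
  rw [div_lt_iff₀ hR] at h2
  simp only [torusRep, latticeIndex, PiLp.sub_apply, latticeVec_apply, Set.mem_Ico]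
  constructor <;> linarith

theorem apply_torusRep {α : Type*} {f : EuclideanSpace ℝ (Fin d) → α}
    (hf : ∀ k x, f (x + latticeVec d R k) = f x) (x : EuclideanSpace ℝ (Fin d)) :
    f (torusRep d R x) = f x := by
  rw [← hf (latticeIndex d R x) (torusRep d R x), torusRep, sub_add_cancel]

theorem measurable_torusRep : Measurable (torusRep d R) := by
  refine measurable_id.sub ?_
  refine (EuclideanSpace.equiv (Fin d) ℝ).symm.continuous.measurable.comp ?_
  refine measurable_pi_lambda _ fun i => Measurable.const_mul ?_ R
  have h : Measurable fun x : EuclideanSpace ℝ (Fin d) => x i / R :=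
    (Continuous.measurable (by fun_prop)).div_const R
  exact (measurable_from_top (f := fun m : ℤ => (m : ℝ))).comp h.floor

theorem measurableSet_torusCube : MeasurableSet (torusCube d R) := by
  have : torusCube d R = ⋂ i, (fun x : EuclideanSpace ℝ (Fin d) => x i) ⁻¹' Set.Ico 0 R := by
    ext x; simp [torusCube]
  rw [this]
  exact MeasurableSet.iInter fun i =>
    (Continuous.measurable (by fun_prop)) measurableSet_Ico

theorem exists_compact_torusCube_subset (d : ℕ) (R : ℝ) :
    ∃ K : Set (EuclideanSpace ℝ (Fin d)), IsCompact K ∧ torusCube d R ⊆ K := by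
  refine ⟨EuclideanSpace.equiv (Fin d) ℝ ⁻¹' Set.univ.pi fun _ => Set.Icc 0 R, ?_, ?_⟩
  · exact (EuclideanSpace.equiv (Fin d) ℝ).toHomeomorph.isClosedEmbedding.isCompact_preimage
      (isCompact_univ_pi fun _ => isCompact_Icc)
  · exact fun x hx i _ => Set.Ico_subset_Icc_self (hx i)

theorem eq_of_add_latticeVec_mem (hR : 0 < R) {x : EuclideanSpace ℝ (Fin d)} {k l : Fin d → ℤ}
    (hk : x + latticeVec d R k ∈ torusCube d R) (hl : x + latticeVec d R l ∈ torusCube d R) :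
    k = l := by
  ext i
  have h1 := hk i
  have h2 := hl i
  simp only [PiLp.add_apply, latticeVec_apply, Set.mem_Ico] at h1 h2
  have h3 : (k i : ℝ) < l i + 1 := lt_of_mul_lt_mul_left (by linarith) hR.le
  have h4 : (l i : ℝ) < k i + 1 := lt_of_mul_lt_mul_left (by linarith) hR.le
  have h5 : k i < l i + 1 := by exact_mod_cast h3
  have h6 : l i < k i + 1 := by exact_mod_cast h4
  omega

theorem map_add_latticeVec_withDensity {f : EuclideanSpace ℝ (Fin d) → ENNReal}
    (hf : ∀ k x, f (x + latticeVec d R k) = f x) (k : Fin d → ℤ) :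
    (volume.withDensity f).map (· + latticeVec d R k) = volume.withDensity f := by
  ext A hA
  have hm : Measurable fun x : EuclideanSpace ℝ (Fin d) => x + latticeVec d R k :=
    measurable_add_const _
  rw [Measure.map_apply hm hA, withDensity_apply _ (hm hA), withDensity_apply _ hA]
  have h := (measurePreserving_add_right volume (latticeVec d R k)).setLIntegral_comp_preimage_emb
    (MeasurableEquiv.addRight (latticeVec d R k)).measurableEmbedding f A
  simp_rw [hf] at h
  exact h

/-- A bound on a pushforward by a lattice equivariant map descends to the torus. -/
theorem map_torusRep_comp_le (hR : 0 < R) {μ ν : Measure (EuclideanSpace ℝ (Fin d))}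
    (hμ : ∀ k, μ.map (· + latticeVec d R k) = μ)
    {T : EuclideanSpace ℝ (Fin d) → EuclideanSpace ℝ (Fin d)} (hT : Measurable T)
    (hTper : ∀ k x, T (x + latticeVec d R k) = T x + latticeVec d R k) (h : μ.map T ≤ ν) :
    (μ.restrict (torusCube d R)).map (torusRep d R ∘ T) ≤ ν.restrict (torusCube d R) := by
  refine Measure.le_iff.2 fun A hA => ?_
  have hQ := measurableSet_torusCube (d := d) (R := R)
  have hB : MeasurableSet (A ∩ torusCube d R) := hA.inter hQ
  have hmT : Measurable (torusRep d R ∘ T) := measurable_torusRep.comp hT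
  rw [Measure.map_apply hmT hA, Measure.restrict_apply (hmT hA), Measure.restrict_apply hA]
  let S : (Fin d → ℤ) → Set (EuclideanSpace ℝ (Fin d)) := fun k =>
    torusCube d R ∩ (fun x => T x - latticeVec d R k) ⁻¹' (A ∩ torusCube d R)
  have hS : ∀ k, MeasurableSet (S k) := fun k => hQ.inter ((hT.sub_const _) hB)
  have hm : ∀ k, Measurable fun x : EuclideanSpace ℝ (Fin d) => x + latticeVec d R k :=
    fun k => measurable_add_const _
  have hsub : (torusRep d R ∘ T) ⁻¹' A ∩ torusCube d R ⊆ ⋃ k, S k := by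
    rintro x ⟨hx, hxQ⟩
    exact Set.mem_iUnion.2 ⟨latticeIndex d R (T x), hxQ, hx, torusRep_mem hR (T x)⟩
  calc μ ((torusRep d R ∘ T) ⁻¹' A ∩ torusCube d R) ≤ μ (⋃ k, S k) := measure_mono hsub
    _ ≤ ∑' k, μ (S k) := measure_iUnion_le _
    _ = ∑' k, μ ((· + latticeVec d R k) ⁻¹' S k) := by
        congr 1
        ext k
        conv_lhs => rw [← hμ k]
        rw [Measure.map_apply (hm k) (hS k)]
    _ = μ (⋃ k, (· + latticeVec d R k) ⁻¹' S k) := by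
        rw [measure_iUnion _ fun k => hm k (hS k)]
        intro k l hkl
        refine Set.disjoint_left.2 fun x hxk hxl => hkl ?_
        exact eq_of_add_latticeVec_mem hR hxk.1 hxl.1
    _ ≤ μ (T ⁻¹' (A ∩ torusCube d R)) := by
        refine measure_mono (Set.iUnion_subset fun k x hx => ?_)
        have := hx.2
        simpa only [Set.mem_preimage, hTper, add_sub_cancel_right] using this
    _ = μ.map T (A ∩ torusCube d R) := (Measure.map_apply hT hB).symm
    _ ≤ ν (A ∩ torusCube d R) := h _

end Torus

section EulerStep

variable {d : ℕ} {R n : ℝ} {ρ₀ φ : EuclideanSpace ℝ (Fin d) → ℝ}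

theorem gradient_add_period {v : EuclideanSpace ℝ (Fin d)} (hφ : ∀ x, φ (x + v) = φ x)
    (x : EuclideanSpace ℝ (Fin d)) : gradient φ (x + v) = gradient φ x := by
  have h : fderiv ℝ φ (x + v) = fderiv ℝ φ x := by
    rw [← fderiv_comp_add_right]
    simp_rw [hφ]
  simp only [gradient, h]

theorem moserDensity_add_latticeVec
    (hρ₀per : ∀ x i, ρ₀ (x + R • EuclideanSpace.single i 1) = ρ₀ x) (s : ℝ) (k : Fin d → ℤ)
    (x : EuclideanSpace ℝ (Fin d)) :
    moserDensity d n ρ₀ s (x + latticeVec d R k) = moserDensity d n ρ₀ s x := by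
  simp only [moserDensity, apply_add_latticeVec hρ₀per]

theorem moserVelocity_add_latticeVec
    (hρ₀per : ∀ x i, ρ₀ (x + R • EuclideanSpace.single i 1) = ρ₀ x)
    (hφper : ∀ x i, φ (x + R • EuclideanSpace.single i 1) = φ x) (s : ℝ) (k : Fin d → ℤ)
    (x : EuclideanSpace ℝ (Fin d)) :
    moserVelocity d n ρ₀ φ s (x + latticeVec d R k) = moserVelocity d n ρ₀ φ s x := by
  simp only [moserVelocity, moserDensity_add_latticeVec hρ₀per,
    gradient_add_period (apply_add_latticeVec hφper k)]

theorem mul_le_moserDensity (hρ₀nonneg : ∀ x, 0 ≤ ρ₀ x) {s : ℝ} (hs : s ≤ 1)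
    (x : EuclideanSpace ℝ (Fin d)) : s * n ≤ moserDensity d n ρ₀ s x := by
  have := mul_nonneg (sub_nonneg.2 hs) (hρ₀nonneg x)
  simp only [moserDensity]
  linarith

theorem measurable_moserVelocity (hρ₀ : ContDiff ℝ (⊤ : ℕ∞) ρ₀) (hφ : ContDiff ℝ (⊤ : ℕ∞) φ)
    (s : ℝ) : Measurable (moserVelocity d n ρ₀ φ s) := by
  have h1 : Measurable (moserDensity d n ρ₀ s) :=
    ((hρ₀.continuous.measurable).const_mul (1 - s)).const_add (s * n)
  exact h1.inv.neg.smul (contDiff_gradient hφ).continuous.measurable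

/-- For small steps, the Euler scheme for `moserVelocity` transports `moserDensity` up to a factor
close to `1`. -/
theorem exists_map_euler_step_le (hR : 0 < R) (hn : 0 < n)
    (hρ₀ : ContDiff ℝ (⊤ : ℕ∞) ρ₀) (hρ₀nonneg : ∀ x, 0 ≤ ρ₀ x)
    (hρ₀per : ∀ x i, ρ₀ (x + R • EuclideanSpace.single i 1) = ρ₀ x)
    (hφ : ContDiff ℝ (⊤ : ℕ∞) φ)
    (hφper : ∀ x i, φ (x + R • EuclideanSpace.single i 1) = φ x)
    (hPDE : ∀ x, -(lap d φ x) = ρ₀ x - n) {ε η : ℝ} (hε : 0 < ε) (hη : 0 < η) :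
    ∃ h₀ > 0, ∀ s t, ε ≤ s → s ≤ t → t ≤ 1 → t - s ≤ h₀ →
      (volume.withDensity fun x => ENNReal.ofReal (moserDensity d n ρ₀ s x)).map
          (fun x => x + (t - s) • moserVelocity d n ρ₀ φ s x) ≤
        ENNReal.ofReal (Real.exp (η * (t - s))) •
          volume.withDensity fun x => ENNReal.ofReal (moserDensity d n ρ₀ t x) := by
  obtain ⟨C, hC, hQC⟩ := exists_compact_torusCube_subset d R
  have hK : IsCompact (Set.Icc ε 1 ×ˢ C) := isCompact_Icc.prod hC
  have hpos : ∀ s ∈ Set.Icc ε 1, ∀ x, 0 < moserDensity d n ρ₀ s x := fun s hs x =>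
    (mul_pos (hε.trans_le hs.1) hn).trans_le (mul_le_moserDensity hρ₀nonneg hs.2 x)
  have hw : ∀ z ∈ Set.Icc ε 1 ×ˢ C,
      ContDiffAt ℝ 2 (Function.uncurry (moserVelocity d n ρ₀ φ)) z := fun z hz =>
    contDiffAt_moserVelocity hρ₀ hφ (hpos _ hz.1 _)
  obtain ⟨a, ha, hstep⟩ := euler_step_density hK
    (fun z _ => (contDiff_moserDensity (n := n) hρ₀).contDiffAt) hw (fun z hz => hpos _ hz.1 _)
    (fun z hz => moserDensity_continuity_equation hρ₀ hφ hPDE (hpos _ hz.1 _)) hη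
  obtain ⟨L, hL⟩ := hK.exists_bound_of_continuousOn
    (f := fun z : ℝ × EuclideanSpace ℝ (Fin d) => fderiv ℝ (moserVelocity d n ρ₀ φ z.1) z.2)
    fun z hz => (contDiffAt_fderiv_snd (hw z hz)).continuousAt.continuousWithinAt
  have hwper := moserVelocity_add_latticeVec (n := n) hρ₀per hφper
  have hDper : ∀ s k x, fderiv ℝ (moserVelocity d n ρ₀ φ s) (x + latticeVec d R k)
      = fderiv ℝ (moserVelocity d n ρ₀ φ s) x := by
    intro s k x
    rw [← fderiv_comp_add_right]
    simp_rw [hwper]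
  have hbound : ∀ s ∈ Set.Icc ε 1, ∀ x, ‖fderiv ℝ (moserVelocity d n ρ₀ φ s) x‖ ≤ L := by
    intro s hs x
    rw [← apply_torusRep (hDper s) x]
    exact hL (s, _) ⟨hs, hQC (torusRep_mem hR x)⟩
  refine ⟨min a (1 / (|L| + 1)), by positivity, fun s t hs hst ht hts => ?_⟩
  set h := t - s with hh
  have hh0 : 0 ≤ h := sub_nonneg.2 hst
  have hsI : s ∈ Set.Icc ε 1 := ⟨hs, hst.trans ht⟩
  have hdiff : Differentiable ℝ (moserVelocity d n ρ₀ φ s) := fun x => by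
    have h1 : ContDiffAt ℝ 2 (Function.uncurry (moserVelocity d n ρ₀ φ)) (s, x) :=
      contDiffAt_moserVelocity hρ₀ hφ (hpos s hsI x)
    exact (h1.comp x (f := fun y => (s, y)) (by fun_prop)).differentiableAt (by norm_num)
  have hF : ∀ x, HasFDerivAt (fun x => x + h • moserVelocity d n ρ₀ φ s x)
      (1 + h • fderiv ℝ (moserVelocity d n ρ₀ φ s) x) x := fun x =>
    (hasFDerivAt_id x).add ((hdiff x).hasFDerivAt.const_smul h)
  refine map_withDensity_le (fun x => (hF x).differentiableAt) ?_ ENNReal.ofReal_ne_top ?_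
  · intro x y hxy
    simp only at hxy
    have h1 : x - y = h • (moserVelocity d n ρ₀ φ s y - moserVelocity d n ρ₀ φ s x) := by
      rw [smul_sub, sub_eq_sub_iff_add_eq_add, hxy, add_comm]
    have h2 : ‖moserVelocity d n ρ₀ φ s y - moserVelocity d n ρ₀ φ s x‖ ≤ L * ‖y - x‖ :=
      convex_univ.norm_image_sub_le_of_norm_fderiv_le (𝕜 := ℝ) (fun z _ => hdiff z)
        (fun z _ => hbound s hsI z) (Set.mem_univ _) (Set.mem_univ _)
    have h3 : ‖x - y‖ ≤ h * (L * ‖x - y‖) := by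
      conv_lhs => rw [h1, norm_smul, Real.norm_of_nonneg hh0]
      rw [norm_sub_rev x y]
      gcongr
    have h4 : h * (|L| + 1) ≤ 1 := by
      rw [← le_div_iff₀ (by positivity)]
      exact hts.trans (min_le_right _ _)
    have h5 : h * L ≤ h * |L| := mul_le_mul_of_nonneg_left (le_abs_self L) hh0
    rcases hh0.eq_or_lt with h0 | h0
    · rw [← h0, zero_mul] at h3
      exact sub_eq_zero.1 (norm_le_zero_iff.1 h3)
    · have h6 : h * L < 1 := by nlinarith
      have h7 : ‖x - y‖ ≤ 0 := by nlinarith [norm_nonneg (x - y)]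
      exact sub_eq_zero.1 (norm_le_zero_iff.1 h7)
  · intro x
    rw [(hF x).fderiv, ← ENNReal.ofReal_mul (abs_nonneg _), ← ENNReal.ofReal_mul (by positivity)]
    refine ENNReal.ofReal_le_ofReal ?_
    have hper : ∀ k y, (moserDensity d n ρ₀ s (y + latticeVec d R k) ≤ (1 + η * h) *
        (moserDensity d n ρ₀ (s + h) (y + latticeVec d R k +
          h • moserVelocity d n ρ₀ φ s (y + latticeVec d R k)) *
          (1 + h • fderiv ℝ (moserVelocity d n ρ₀ φ s) (y + latticeVec d R k)).det)) =
        (moserDensity d n ρ₀ s y ≤ (1 + η * h) *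
        (moserDensity d n ρ₀ (s + h) (y + h • moserVelocity d n ρ₀ φ s y) *
          (1 + h • fderiv ℝ (moserVelocity d n ρ₀ φ s) y).det)) := by
      intro k y
      rw [hwper, hDper, add_right_comm, moserDensity_add_latticeVec hρ₀per,
        moserDensity_add_latticeVec hρ₀per]
    have h1 := hstep (s, torusRep d R x) ⟨hsI, hQC (torusRep_mem hR x)⟩ h
      ⟨hh0, hts.trans (min_le_left _ _)⟩
    have h2 : moserDensity d n ρ₀ s x ≤ (1 + η * h) *
        (moserDensity d n ρ₀ (s + h) (x + h • moserVelocity d n ρ₀ φ s x) *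
          (1 + h • fderiv ℝ (moserVelocity d n ρ₀ φ s) x).det) := by
      have := apply_torusRep (f := fun y => moserDensity d n ρ₀ s y ≤ (1 + η * h) *
        (moserDensity d n ρ₀ (s + h) (y + h • moserVelocity d n ρ₀ φ s y) *
          (1 + h • fderiv ℝ (moserVelocity d n ρ₀ φ s) y).det)) hper x
      exact this.mp h1
    have hst' : s + h = t := by rw [hh]; ring
    rw [hst'] at h2
    refine h2.trans ?_
    have h3 : 0 ≤ moserDensity d n ρ₀ t (x + h • moserVelocity d n ρ₀ φ s x) :=
      (hpos t ⟨hs.trans hst, ht⟩ _).le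
    have h4 : 1 + η * h ≤ Real.exp (η * h) := by
      linarith [Real.add_one_le_exp (η * h)]
    have h5 : 0 ≤ 1 + η * h := by positivity
    rw [mul_comm (|_|)]
    calc _ ≤ (1 + η * h) * (moserDensity d n ρ₀ t (x + h • moserVelocity d n ρ₀ φ s x) *
          |(1 + h • fderiv ℝ (moserVelocity d n ρ₀ φ s) x).det|) := by
          gcongr
          exact le_abs_self _
      _ ≤ _ := by gcongr

end EulerStep

/-- The explicit Euler scheme for the velocity field `w` on the time grid `s`. -/
noncomputable def eulerScheme {E : Type*} [AddCommGroup E] [Module ℝ E] (w : ℝ → E → E)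
    (s : ℕ → ℝ) : ℕ → E → E
  | 0, x => x
  | k + 1, x => eulerScheme w s k x + (s (k + 1) - s k) • w (s k) (eulerScheme w s k x)

section EulerScheme

variable {E : Type*} [NormedAddCommGroup E] [NormedSpace ℝ E] {w : ℝ → E → E} {s : ℕ → ℝ}

theorem eulerScheme_add {v : E} (hw : ∀ t x, w t (x + v) = w t x) (k : ℕ) (x : E) :
    eulerScheme w s k (x + v) = eulerScheme w s k x + v := by
  induction k with
  | zero => rfl
  | succ k ih => simp only [eulerScheme, ih, hw, add_right_comm]

theorem norm_eulerScheme_sub_le (hs : Monotone s) (N : ℕ) (x : E) :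
    ‖x - eulerScheme w s N x‖ ≤
      ∑ k ∈ Finset.range N, (s (k + 1) - s k) * ‖w (s k) (eulerScheme w s k x)‖ := by
  induction N with
  | zero => simp [eulerScheme]
  | succ N ih =>
    rw [Finset.sum_range_succ, eulerScheme, ← sub_sub]
    refine (norm_sub_le _ _).trans (add_le_add ih ?_)
    rw [norm_smul, Real.norm_of_nonneg (sub_nonneg.2 (hs N.le_succ))]

variable [MeasurableSpace E] [BorelSpace E] [SecondCountableTopology E]

theorem measurable_eulerScheme (hw : ∀ t, Measurable (w t)) (k : ℕ) :
    Measurable (eulerScheme w s k) := by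
  induction k with
  | zero => exact measurable_id
  | succ k ih => exact ih.add (((hw _).comp ih).const_smul _)

theorem map_eulerScheme_le (hw : ∀ t, Measurable (w t)) {μ : ℕ → Measure E} {η : ℝ} {N : ℕ}
    (hstep : ∀ k < N, (μ k).map (fun x => x + (s (k + 1) - s k) • w (s k) x) ≤
      ENNReal.ofReal (Real.exp (η * (s (k + 1) - s k))) • μ (k + 1)) :
    ∀ k ≤ N, (μ 0).map (eulerScheme w s k) ≤
      ENNReal.ofReal (Real.exp (η * (s k - s 0))) • μ k := by
  intro k
  induction k with
  | zero =>
    intro _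
    have : eulerScheme w s 0 = id := rfl
    simp [this]
  | succ k ih =>
    intro hk
    have hF : Measurable fun x => x + (s (k + 1) - s k) • w (s k) x :=
      measurable_id.add ((hw _).const_smul _)
    have hcomp : eulerScheme w s (k + 1) =
        (fun x => x + (s (k + 1) - s k) • w (s k) x) ∘ eulerScheme w s k := rfl
    rw [hcomp, ← Measure.map_map hF (measurable_eulerScheme hw k)]
    refine (Measure.map_mono (ih (Nat.le_of_succ_le hk)) hF).trans ?_
    rw [Measure.map_smul]
    calc _ ≤ ENNReal.ofReal (Real.exp (η * (s k - s 0))) •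
          (ENNReal.ofReal (Real.exp (η * (s (k + 1) - s k))) • μ (k + 1)) := by
          gcongr
          exact hstep k hk
      _ = _ := by
          rw [smul_smul, ← ENNReal.ofReal_mul (Real.exp_nonneg _), ← Real.exp_add]
          congr 3
          ring

end EulerScheme

/-- Jensen's inequality for a sub-probability on a finite set given by increments. -/
theorem rpow_sum_increments_le {p : ℝ} (hp : 1 ≤ p) {t b : ℕ → ℝ} (ht : Monotone t)
    (ht0 : 0 ≤ t 0) {N : ℕ} (htN : t N ≤ 1) (hb : ∀ k, 0 ≤ b k) :
    (∑ k ∈ Finset.range N, (t (k + 1) - t k) * b k) ^ p ≤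
      ∑ k ∈ Finset.range N, (t (k + 1) - t k) * b k ^ p := by
  have hp0 : p ≠ 0 := by linarith
  let u : ℕ → ℝ := fun k => Nat.casesOn k (1 - (t N - t 0)) fun k => t (k + 1) - t k
  let z : ℕ → ℝ := fun k => Nat.casesOn k 0 b
  have h := Real.rpow_arith_mean_le_arith_mean_rpow (Finset.range (N + 1)) u z ?_ ?_ ?_ hp
  · simpa [Finset.sum_range_succ', u, z, Real.zero_rpow hp0] using h
  · rintro (_ | k) _
    · change 0 ≤ 1 - (t N - t 0)
      linarith
    · exact sub_nonneg.2 (ht k.le_succ)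
  · rw [Finset.sum_range_succ']
    change ∑ k ∈ Finset.range N, (t (k + 1) - t k) + (1 - (t N - t 0)) = 1
    rw [Finset.sum_range_sub]
    ring
  · rintro (_ | k) _
    · exact le_rfl
    · exact hb k

theorem rpow_sub_one_le {p r : ℝ} (hp : 1 ≤ p) (hr : 1 ≤ r) :
    r ^ p - 1 ≤ p * r ^ (p - 1) * (r - 1) := by
  have hr0 : 0 < r := by linarith
  have h := one_add_mul_self_le_rpow_one_add (s := r⁻¹ - 1) (by linarith [inv_pos.2 hr0]) hp
  rw [add_sub_cancel, Real.inv_rpow hr0.le] at h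
  have h2 := mul_le_mul_of_nonneg_left h (Real.rpow_nonneg hr0.le p)
  rw [mul_inv_cancel₀ (Real.rpow_pos_of_pos hr0 p).ne'] at h2
  have h3 : r ^ p = r ^ (p - 1) * r := by
    rw [← Real.rpow_add_one hr0.ne', sub_add_cancel]
  have h4 : r ^ p * (1 + p * (r⁻¹ - 1)) = r ^ p - p * r ^ (p - 1) * (r - 1) := by
    rw [h3]; field_simp; ring
  linarith

section Cost

variable {d : ℕ} {R n : ℝ} {ρ₀ φ : EuclideanSpace ℝ (Fin d) → ℝ}

theorem pdist_nonneg (x y : EuclideanSpace ℝ (Fin d)) : 0 ≤ pdist d R x y :=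
  Real.iInf_nonneg fun _ => norm_nonneg _

theorem pdist_le_norm (x y : EuclideanSpace ℝ (Fin d)) (k : Fin d → ℤ) :
    pdist d R x y ≤ ‖x - y - latticeVec d R k‖ :=
  ciInf_le ⟨0, by rintro _ ⟨k, rfl⟩; exact norm_nonneg _⟩ k

theorem pdist_torusRep_le (x y : EuclideanSpace ℝ (Fin d)) :
    pdist d R x (torusRep d R y) ≤ ‖x - y‖ := by
  refine (pdist_le_norm _ _ (latticeIndex d R y)).trans_eq ?_
  rw [torusRep]
  congr 1
  abel

/-- The kinetic energy of `moserVelocity` at time `s` is controlled by the energy of `φ`. -/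
theorem lintegral_moserVelocity_le (hn : 0 < n) (hρ₀ : ContDiff ℝ (⊤ : ℕ∞) ρ₀)
    (hρ₀nonneg : ∀ x, 0 ≤ ρ₀ x) (hφ : ContDiff ℝ (⊤ : ℕ∞) φ) {p s : ℝ} (hp : 1 ≤ p) (hs : 0 < s)
    (hs1 : s ≤ 1) :
    ∫⁻ x in torusCube d R, ENNReal.ofReal (‖moserVelocity d n ρ₀ φ s x‖ ^ p)
        ∂(volume.withDensity fun x => ENNReal.ofReal (moserDensity d n ρ₀ s x)) ≤
      ENNReal.ofReal ((s * n) ^ (1 - p)) *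
        ∫⁻ x in torusCube d R, ENNReal.ofReal (‖gradient φ x‖ ^ p) := by
  have hm1 : Measurable fun x => ENNReal.ofReal (moserDensity d n ρ₀ s x) :=
    (((hρ₀.continuous.measurable).const_mul (1 - s)).const_add (s * n)).ennreal_ofReal
  have hm2 : Measurable fun x => ENNReal.ofReal (‖moserVelocity d n ρ₀ φ s x‖ ^ p) :=
    ((measurable_moserVelocity hρ₀ hφ s).norm.pow_const p).ennreal_ofReal
  rw [restrict_withDensity measurableSet_torusCube, lintegral_withDensity_eq_lintegral_mul _ hm1 hm2,
    ← lintegral_const_mul' _ _ ENNReal.ofReal_ne_top]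
  refine lintegral_mono fun x => ?_
  have hsn : 0 < s * n := mul_pos hs hn
  have hle := mul_le_moserDensity (n := n) hρ₀nonneg hs1 x
  have hpos := hsn.trans_le hle
  rw [Pi.mul_apply, ← ENNReal.ofReal_mul hpos.le, ← ENNReal.ofReal_mul (by positivity)]
  refine ENNReal.ofReal_le_ofReal ?_
  rw [moserVelocity, norm_smul, norm_neg, norm_inv, Real.norm_of_nonneg hpos.le,
    Real.mul_rpow (by positivity) (norm_nonneg _), Real.inv_rpow hpos.le, ← Real.rpow_neg hpos.le,
    ← mul_assoc]
  gcongr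
  calc moserDensity d n ρ₀ s x * moserDensity d n ρ₀ s x ^ (-p)
      = moserDensity d n ρ₀ s x ^ (1 - p) := by
        rw [sub_eq_add_neg, Real.rpow_add hpos, Real.rpow_one]
    _ ≤ (s * n) ^ (1 - p) := Real.rpow_le_rpow_of_nonpos hsn hle (by linarith)

theorem lintegral_comp_le_of_map_le (hR : 0 < R) {μ ν : Measure (EuclideanSpace ℝ (Fin d))}
    (hμ : ∀ k, μ.map (· + latticeVec d R k) = μ)
    {T : EuclideanSpace ℝ (Fin d) → EuclideanSpace ℝ (Fin d)} (hT : Measurable T)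
    (hTper : ∀ k x, T (x + latticeVec d R k) = T x + latticeVec d R k) (h : μ.map T ≤ ν)
    {g : EuclideanSpace ℝ (Fin d) → ENNReal} (hg : Measurable g)
    (hgper : ∀ k x, g (x + latticeVec d R k) = g x) :
    ∫⁻ x in torusCube d R, g (T x) ∂μ ≤ ∫⁻ x in torusCube d R, g x ∂ν := by
  calc ∫⁻ x in torusCube d R, g (T x) ∂μ
      = ∫⁻ x in torusCube d R, g ((torusRep d R ∘ T) x) ∂μ := by
        simp only [Function.comp_apply, apply_torusRep hgper]
    _ = ∫⁻ y, g y ∂((μ.restrict (torusCube d R)).map (torusRep d R ∘ T)) :=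
        (lintegral_map hg (measurable_torusRep.comp hT)).symm
    _ ≤ _ := lintegral_mono' (map_torusRep_comp_le hR hμ hT hTper h) le_rfl

/-- Transport of `moserDensity` at time `ε` to a measure bounded by `κ n`, at controlled cost. -/
theorem exists_approx_transport (hR : 0 < R) (hn : 0 < n) {p : ℝ} (hp : 1 ≤ p)
    (hρ₀ : ContDiff ℝ (⊤ : ℕ∞) ρ₀) (hρ₀nonneg : ∀ x, 0 ≤ ρ₀ x)
    (hρ₀per : ∀ x i, ρ₀ (x + R • EuclideanSpace.single i 1) = ρ₀ x)
    (hφ : ContDiff ℝ (⊤ : ℕ∞) φ)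
    (hφper : ∀ x i, φ (x + R • EuclideanSpace.single i 1) = φ x)
    (hPDE : ∀ x, -(lap d φ x) = ρ₀ x - n) {ε κ : ℝ} (hε : 0 < ε) (hε1 : ε < 1) (hκ : 1 < κ) :
    ∃ S : EuclideanSpace ℝ (Fin d) → EuclideanSpace ℝ (Fin d), Measurable S ∧
      ((volume.withDensity fun x => ENNReal.ofReal (moserDensity d n ρ₀ ε x)).restrict
          (torusCube d R)).map S ≤
        ENNReal.ofReal κ • ENNReal.ofReal n • volume.restrict (torusCube d R) ∧
      ∫⁻ x in torusCube d R, ENNReal.ofReal (pdist d R x (S x) ^ p)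
          ∂(volume.withDensity fun x => ENNReal.ofReal (moserDensity d n ρ₀ ε x)) ≤
        ENNReal.ofReal (κ * p ^ p * n ^ (1 - p)) *
          ∫⁻ x in torusCube d R, ENNReal.ofReal (‖gradient φ x‖ ^ p) := by
  have hp0 : 0 < p := by linarith
  set η := Real.log κ / 2 with hη
  have hηpos : 0 < η := half_pos (Real.log_pos hκ)
  have hηκ : Real.exp η * Real.exp η = κ := by
    rw [← Real.exp_add, hη, add_halves, Real.exp_log (by linarith)]
  obtain ⟨h₀, hh₀, hstep⟩ :=
    exists_map_euler_step_le hR hn hρ₀ hρ₀nonneg hρ₀per hφ hφper hPDE hε hηpos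
  obtain ⟨t₀, ht₀, ht₀1, ht₀ε⟩ : ∃ t₀ : ℝ, 0 < t₀ ∧ t₀ < 1 ∧ t₀ ^ p = ε :=
    ⟨ε ^ p⁻¹, Real.rpow_pos_of_pos hε _, Real.rpow_lt_one hε.le hε1 (inv_pos.2 hp0),
      Real.rpow_inv_rpow hε.le hp0.ne'⟩
  obtain ⟨N, r, hr1, hrN, hrstep, hrcost⟩ : ∃ (N : ℕ) (r : ℝ), 1 ≤ r ∧ t₀ * r ^ N = 1 ∧
      r ^ p - 1 ≤ h₀ ∧ (r ^ (p - 1)) ^ p ≤ Real.exp η := by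
    have hlim : Filter.Tendsto (fun N : ℕ => t₀⁻¹ ^ (1 / ((N : ℝ) + 1))) Filter.atTop
        (nhds 1) := by
      have := (Real.continuousAt_const_rpow (a := t₀⁻¹) (b := 0) (inv_pos.2 ht₀).ne').tendsto.comp
        (tendsto_one_div_add_atTop_nhds_zero_nat (𝕜 := ℝ))
      simpa [Function.comp_def] using this
    have hc1 : ContinuousAt (fun r : ℝ => r ^ p - 1) 1 :=
      (Real.continuousAt_rpow_const 1 p (Or.inl one_ne_zero)).sub continuousAt_const
    have hc2 : ContinuousAt (fun r : ℝ => (r ^ (p - 1)) ^ p) 1 :=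
      (Real.continuousAt_rpow_const 1 (p - 1) (Or.inl one_ne_zero)).rpow_const (Or.inr hp0.le)
    have he1 := hlim.eventually (hc1.eventually_lt_const (u := h₀) (by simpa using hh₀))
    have he2 := hlim.eventually (hc2.eventually_lt_const
      (u := Real.exp η) (by simpa using hηpos))
    obtain ⟨N, h1, h2⟩ := (he1.and he2).exists
    refine ⟨N + 1, _, Real.one_le_rpow (one_le_inv₀ ht₀ |>.2 ht₀1.le) (by positivity), ?_, h1.le,
      h2.le⟩
    rw [← Real.rpow_natCast, ← Real.rpow_mul (inv_pos.2 ht₀).le]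
    push_cast
    rw [one_div_mul_cancel (by positivity), Real.rpow_one, mul_inv_cancel₀ ht₀.ne']
  have hr0 : 0 < r := by linarith
  let t : ℕ → ℝ := fun k => t₀ * r ^ k
  let s : ℕ → ℝ := fun k => t k ^ p
  have htpos : ∀ k, 0 < t k := fun k => by positivity
  have htmono : Monotone t := fun i j hij =>
    mul_le_mul_of_nonneg_left (pow_le_pow_right₀ hr1 hij) ht₀.le
  have hsmono : Monotone s := fun i j hij =>
    Real.rpow_le_rpow (htpos i).le (htmono hij) hp0.le
  have ht0 : t 0 = t₀ := by simp [t]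
  have hs0 : s 0 = ε := by simp only [s, ht0, ht₀ε]
  have hsN : s N = 1 := by simp only [s, t, hrN, Real.one_rpow]
  have hspos : ∀ k, 0 < s k := fun k => Real.rpow_pos_of_pos (htpos k) p
  have hsucc : ∀ k, t (k + 1) = r * t k := fun k => by simp only [t, pow_succ]; ring
  have hsdiff : ∀ k, s (k + 1) - s k = s k * (r ^ p - 1) := fun k => by
    simp only [s, hsucc, Real.mul_rpow hr0.le (htpos k).le]; ring
  have hsle : ∀ k ≤ N, s k ≤ 1 := fun k hk => hsN ▸ hsmono hk
  have hrp : 0 ≤ r ^ p - 1 := sub_nonneg.2 (Real.one_le_rpow hr1 hp0.le)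
  set w := moserVelocity d n ρ₀ φ with hw
  have hwm : ∀ s, Measurable (w s) := measurable_moserVelocity hρ₀ hφ
  have hwper : ∀ s k x, w s (x + latticeVec d R k) = w s x :=
    moserVelocity_add_latticeVec hρ₀per hφper
  let μ : ℕ → Measure (EuclideanSpace ℝ (Fin d)) := fun k =>
    volume.withDensity fun x => ENNReal.ofReal (moserDensity d n ρ₀ (s k) x)
  have hμ0 : μ 0 = volume.withDensity fun x => ENNReal.ofReal (moserDensity d n ρ₀ ε x) := by
    simp only [μ, hs0]
  have hμper : ∀ k, (μ 0).map (· + latticeVec d R k) = μ 0 :=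
    map_add_latticeVec_withDensity fun k x => by rw [moserDensity_add_latticeVec hρ₀per]
  let T := eulerScheme w s
  have hTm : ∀ k, Measurable (T k) := measurable_eulerScheme hwm
  have hTper : ∀ k l x, T k (x + latticeVec d R l) = T k x + latticeVec d R l := fun k l x =>
    eulerScheme_add (fun s x => hwper s l x) k x
  have hmap : ∀ k ≤ N, (μ 0).map (T k) ≤ ENNReal.ofReal (Real.exp η) • μ k := by
    intro k hk
    refine (map_eulerScheme_le hwm (N := N) (η := η) (fun j hj => ?_) k hk).trans ?_
    · refine hstep (s j) (s (j + 1)) (hs0 ▸ hsmono (Nat.zero_le j)) (hsmono j.le_succ)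
        (hsle _ hj) ?_
      rw [hsdiff]
      exact (mul_le_of_le_one_left hrp (hsle j hj.le)).trans hrstep
    · gcongr
      have : s k - s 0 ≤ 1 := by linarith [hsle k hk, hspos 0]
      nlinarith
  refine ⟨torusRep d R ∘ T N, measurable_torusRep.comp (hTm N), ?_, ?_⟩
  · rw [← hμ0]
    refine (map_torusRep_comp_le hR hμper (hTm N) (hTper N) (hmap N le_rfl)).trans ?_
    have hμN : μ N = ENNReal.ofReal n • volume := by
      simp only [μ, hsN]
      rw [← withDensity_const]
      simp [moserDensity]
    rw [hμN, Measure.restrict_smul, Measure.restrict_smul]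
    gcongr
    rw [← hηκ]
    exact le_mul_of_one_le_left (Real.exp_nonneg _) (Real.one_le_exp hηpos.le)
  · rw [← hμ0]
    set I := ∫⁻ x in torusCube d R, ENNReal.ofReal (‖gradient φ x‖ ^ p) with hI
    let a : ℕ → ℝ := fun k => (t (k + 1) - t k) * (p * r ^ (p - 1) * t k ^ (p - 1)) ^ p
    have ha : ∀ k, 0 ≤ a k := fun k =>
      mul_nonneg (sub_nonneg.2 (htmono k.le_succ)) (by have := htpos k; positivity)
    have hpt : ∀ x, pdist d R x (torusRep d R (T N x)) ^ p ≤
        ∑ k ∈ Finset.range N, a k * ‖w (s k) (T k x)‖ ^ p := by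
      intro x
      have h1 : pdist d R x (torusRep d R (T N x)) ≤ ∑ k ∈ Finset.range N,
          (t (k + 1) - t k) * (p * r ^ (p - 1) * t k ^ (p - 1) * ‖w (s k) (T k x)‖) := by
        refine ((pdist_torusRep_le _ _).trans (norm_eulerScheme_sub_le hsmono N x)).trans ?_
        refine Finset.sum_le_sum fun k _ => ?_
        rw [← mul_assoc]
        refine mul_le_mul_of_nonneg_right ?_ (norm_nonneg _)
        have h2 : s k = t k ^ (p - 1) * t k := by
          rw [← Real.rpow_add_one (htpos k).ne', sub_add_cancel]
        rw [hsdiff, hsucc, h2]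
        have h3 : 0 ≤ t k ^ (p - 1) * t k := h2 ▸ (hspos k).le
        calc _ ≤ t k ^ (p - 1) * t k * (p * r ^ (p - 1) * (r - 1)) :=
              mul_le_mul_of_nonneg_left (rpow_sub_one_le hp hr1) h3
          _ = _ := by ring
      refine (Real.rpow_le_rpow (pdist_nonneg _ _) h1 hp0.le).trans ?_
      refine (rpow_sum_increments_le hp htmono (htpos 0).le (le_of_eq hrN) fun k => ?_).trans_eq ?_
      · have := htpos k
        positivity
      · refine Finset.sum_congr rfl fun k _ => ?_
        have := htpos k
        rw [Real.mul_rpow (by positivity) (norm_nonneg _), ← mul_assoc]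
    have hterm : ∀ k < N, ∫⁻ x in torusCube d R, ENNReal.ofReal (‖w (s k) (T k x)‖ ^ p) ∂μ 0 ≤
        ENNReal.ofReal (Real.exp η * (s k * n) ^ (1 - p)) * I := by
      intro k hk
      have hmeas : Measurable fun y => ENNReal.ofReal (‖w (s k) y‖ ^ p) :=
        ((hwm _).norm.pow_const p).ennreal_ofReal
      refine (lintegral_comp_le_of_map_le hR hμper (hTm k) (hTper k) (hmap k hk.le) hmeas
        fun l x => by rw [hwper]).trans ?_
      rw [Measure.restrict_smul, lintegral_smul_measure, ENNReal.ofReal_mul (Real.exp_nonneg _),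
        mul_assoc, smul_eq_mul]
      gcongr
      exact lintegral_moserVelocity_le hn hρ₀ hρ₀nonneg hφ hp (hspos k) (hsle k hk.le)
    have hcoef : ∀ k, a k * (Real.exp η * (s k * n) ^ (1 - p)) =
        (t (k + 1) - t k) * (p ^ p * (r ^ (p - 1)) ^ p * Real.exp η * n ^ (1 - p)) := by
      intro k
      have htk := htpos k
      have h1 : (t k ^ (p - 1)) ^ p * (t k ^ p) ^ (1 - p) = 1 := by
        rw [← Real.rpow_mul htk.le, ← Real.rpow_mul htk.le, ← Real.rpow_add htk]
        ring_nf
        exact Real.rpow_zero _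
      simp only [a, s]
      rw [Real.mul_rpow (by positivity) (by positivity), Real.mul_rpow hp0.le (by positivity),
        Real.mul_rpow (by positivity) hn.le]
      linear_combination (t (k + 1) - t k) * p ^ p * (r ^ (p - 1)) ^ p * Real.exp η
        * n ^ (1 - p) * h1
    calc ∫⁻ x in torusCube d R, ENNReal.ofReal (pdist d R x ((torusRep d R ∘ T N) x) ^ p) ∂μ 0
        ≤ ∫⁻ x in torusCube d R, ∑ k ∈ Finset.range N,
            ENNReal.ofReal (a k) * ENNReal.ofReal (‖w (s k) (T k x)‖ ^ p) ∂μ 0 := by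
          refine lintegral_mono fun x => ?_
          refine (ENNReal.ofReal_le_ofReal (hpt x)).trans_eq ?_
          rw [ENNReal.ofReal_sum_of_nonneg fun k _ => mul_nonneg (ha k) (by positivity)]
          exact Finset.sum_congr rfl fun k _ => ENNReal.ofReal_mul (ha k)
      _ = ∑ k ∈ Finset.range N, ENNReal.ofReal (a k) *
            ∫⁻ x in torusCube d R, ENNReal.ofReal (‖w (s k) (T k x)‖ ^ p) ∂μ 0 := by
          rw [lintegral_finsetSum]
          · exact Finset.sum_congr rfl fun k _ => lintegral_const_mul' _ _ ENNReal.ofReal_ne_top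
          · exact fun k _ =>
              ((((hwm _).comp (hTm k)).norm.pow_const p).ennreal_ofReal).const_mul _
      _ ≤ ∑ k ∈ Finset.range N, ENNReal.ofReal (a k) *
            (ENNReal.ofReal (Real.exp η * (s k * n) ^ (1 - p)) * I) := by
          refine Finset.sum_le_sum fun k hk => ?_
          gcongr
          exact hterm k (Finset.mem_range.1 hk)
      _ = ENNReal.ofReal (∑ k ∈ Finset.range N, (t (k + 1) - t k) *
            (p ^ p * (r ^ (p - 1)) ^ p * Real.exp η * n ^ (1 - p))) * I := by
          rw [ENNReal.ofReal_sum_of_nonneg, Finset.sum_mul]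
          · refine Finset.sum_congr rfl fun k _ => ?_
            rw [← mul_assoc, ← ENNReal.ofReal_mul (ha k), hcoef]
          · exact fun k _ => mul_nonneg (sub_nonneg.2 (htmono k.le_succ)) (by positivity)
      _ ≤ ENNReal.ofReal (κ * p ^ p * n ^ (1 - p)) * I := by
          gcongr
          rw [← Finset.sum_mul, Finset.sum_range_sub]
          have h1 : t N - t 0 ≤ 1 := by
            have : t N = 1 := hrN
            linarith [htpos 0]
          calc (t N - t 0) * (p ^ p * (r ^ (p - 1)) ^ p * Real.exp η * n ^ (1 - p))
              ≤ 1 * (p ^ p * Real.exp η * Real.exp η * n ^ (1 - p)) := by gcongr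
            _ = κ * p ^ p * n ^ (1 - p) := by rw [← hηκ]; ring

end Cost

section Coupling

variable {d : ℕ} {R : ℝ}

theorem exists_pdist_le (hR : 0 < R) :
    ∃ D, ∀ x y : EuclideanSpace ℝ (Fin d), pdist d R x y ≤ D := by
  obtain ⟨C, hC, hQC⟩ := exists_compact_torusCube_subset d R
  refine ⟨Metric.diam C, fun x y => ?_⟩
  refine (pdist_le_norm x y (latticeIndex d R x - latticeIndex d R y)).trans ?_
  have h : x - y - latticeVec d R (latticeIndex d R x - latticeIndex d R y) =
      torusRep d R x - torusRep d R y := by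
    ext i
    simp [torusRep, mul_sub]
    ring
  rw [h, ← dist_eq_norm]
  exact Metric.dist_le_diam_of_mem hC.isBounded (hQC (torusRep_mem hR x)) (hQC (torusRep_mem hR y))

theorem volume_torusCube : volume (torusCube d R) = ENNReal.ofReal R ^ d := by
  have h : torusCube d R = WithLp.ofLp ⁻¹' (Set.univ.pi fun _ => Set.Ico 0 R) := by
    ext x; simp [torusCube]
  rw [h, (PiLp.volume_preserving_ofLp (Fin d)).measure_preimage
    (MeasurableSet.univ_pi fun _ => measurableSet_Ico).nullMeasurableSet, Real.volume_pi_Ico]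
  simp

theorem WpTorusPow_le_lintegral {p : ℝ} {μ ν : Measure (EuclideanSpace ℝ (Fin d))}
    {π : Measure (EuclideanSpace ℝ (Fin d) × EuclideanSpace ℝ (Fin d))}
    (h1 : π.fst = μ) (h2 : π.snd = ν) {c : ℝ} (hc : 0 ≤ c)
    (h : ∫⁻ q, ENNReal.ofReal (pdist d R q.1 q.2 ^ p) ∂π ≤ ENNReal.ofReal c) :
    WpTorusPow d R p μ ν ≤ c := by
  have hnonneg : ∀ q : EuclideanSpace ℝ (Fin d) × EuclideanSpace ℝ (Fin d),
      0 ≤ pdist d R q.1 q.2 ^ p := fun q => Real.rpow_nonneg (pdist_nonneg _ _) p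
  have hle : ∫ q, pdist d R q.1 q.2 ^ p ∂π ≤ c := by
    refine ((Real.le_norm_self _).trans (norm_integral_le_lintegral_norm _)).trans ?_
    simp_rw [Real.norm_of_nonneg (hnonneg _)]
    exact ENNReal.toReal_le_of_le_ofReal hc h
  have hmem : WpTorusPow d R p μ ν ≤ ∫ q, pdist d R q.1 q.2 ^ p ∂π := by
    apply csInf_le
    · refine ⟨0, ?_⟩
      rintro _ ⟨_, -, -, rfl⟩
      exact integral_nonneg hnonneg
    · exact ⟨π, h1, h2, rfl⟩
  exact hmem.trans hle

/-- A map transporting the fraction `a` of `α` below `β` can be completed to a coupling by a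
product measure. -/
theorem WpTorusPow_le_of_map_le {p : ℝ} (hp : 0 ≤ p) {α β : Measure (EuclideanSpace ℝ (Fin d))}
    [IsFiniteMeasure α] [IsFiniteMeasure β] (hα : α Set.univ ≠ 0)
    (hmass : α Set.univ = β Set.univ) {a : ℝ} (ha : 0 ≤ a) (ha1 : a ≤ 1)
    {S : EuclideanSpace ℝ (Fin d) → EuclideanSpace ℝ (Fin d)} (hS : Measurable S)
    (hmap : (ENNReal.ofReal a • α).map S ≤ β) {D : ℝ}
    (hD : ∀ x y : EuclideanSpace ℝ (Fin d), pdist d R x y ≤ D) {c : ℝ} (hc : 0 ≤ c)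
    (hcost : ∫⁻ x, ENNReal.ofReal (pdist d R x (S x) ^ p) ∂(ENNReal.ofReal a • α) ≤
      ENNReal.ofReal c) :
    WpTorusPow d R p α β ≤ c + D ^ p * ((1 - a) * α.real Set.univ) := by
  set M := α Set.univ with hM
  have hMtop : M ≠ ⊤ := measure_ne_top _ _
  have hD0 : 0 ≤ D := (pdist_nonneg 0 0).trans (hD 0 0)
  have : IsFiniteMeasure (ENNReal.ofReal a • α) := α.smul_finite ENNReal.ofReal_ne_top
  set γ := β - (ENNReal.ofReal a • α).map S with hγ
  have hγadd : γ + (ENNReal.ofReal a • α).map S = β := Measure.sub_add_cancel_of_le hmap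
  have hγfin : IsFiniteMeasure γ := isFiniteMeasure_of_le β (Measure.sub_le)
  have h1a : ENNReal.ofReal (1 - a) + ENNReal.ofReal a = 1 := by
    rw [← ENNReal.ofReal_add (by linarith) ha, sub_add_cancel, ENNReal.ofReal_one]
  have hγM : γ Set.univ = ENNReal.ofReal (1 - a) * M := by
    have h := congrArg (fun m => m Set.univ) hγadd
    simp only [Measure.add_apply, Measure.map_apply hS MeasurableSet.univ, Set.preimage_univ,
      Measure.smul_apply, smul_eq_mul, ← hmass, ← hM] at h
    have h' : ENNReal.ofReal (1 - a) * M + ENNReal.ofReal a * M = M := by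
      rw [← add_mul, h1a, one_mul]
    exact (ENNReal.add_left_inj (ENNReal.mul_ne_top ENNReal.ofReal_ne_top hMtop)).1 (h.trans h'.symm)
  have hgraph : Measurable fun x => (x, S x) := measurable_id.prodMk hS
  refine WpTorusPow_le_lintegral
    (π := (ENNReal.ofReal a • α).map (fun x => (x, S x)) + M⁻¹ • α.prod γ) ?_ ?_ ?_ ?_
  · rw [Measure.fst, Measure.map_add _ _ measurable_fst, Measure.map_map measurable_fst hgraph,
      Measure.map_smul, Measure.map_smul, Measure.map_fst_prod, hγM, smul_smul, mul_left_comm,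
      ENNReal.inv_mul_cancel hα hMtop, mul_one]
    have : Prod.fst ∘ (fun x => (x, S x)) = id := rfl
    rw [this, Measure.map_id, ← add_smul, add_comm, h1a, one_smul]
  · rw [Measure.snd, Measure.map_add _ _ measurable_snd, Measure.map_map measurable_snd hgraph,
      Measure.map_smul (M⁻¹), Measure.map_snd_prod, smul_smul, ENNReal.inv_mul_cancel hα hMtop,
      one_smul, add_comm]
    exact hγadd
  · have := mul_nonneg (sub_nonneg.2 ha1) (measureReal_nonneg (μ := α) (s := Set.univ))
    positivity
  · rw [lintegral_add_measure, lintegral_smul_measure, smul_eq_mul,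
      ENNReal.ofReal_add hc (by
        have := mul_nonneg (sub_nonneg.2 ha1) (measureReal_nonneg (μ := α) (s := Set.univ))
        positivity)]
    refine add_le_add ((lintegral_map_le _ _).trans hcost) ?_
    calc M⁻¹ * ∫⁻ q, ENNReal.ofReal (pdist d R q.1 q.2 ^ p) ∂(α.prod γ)
        ≤ M⁻¹ * ∫⁻ _, ENNReal.ofReal (D ^ p) ∂(α.prod γ) := by
          gcongr with q
          · exact pdist_nonneg _ _
          · exact hD _ _
      _ = M⁻¹ * (ENNReal.ofReal (D ^ p) * (M * (ENNReal.ofReal (1 - a) * M))) := by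
          rw [lintegral_const, ← Set.univ_prod_univ, Measure.prod_prod, hγM]
      _ = (M⁻¹ * M) * (ENNReal.ofReal (D ^ p) * (ENNReal.ofReal (1 - a) * M)) := by ring
      _ = ENNReal.ofReal (D ^ p * ((1 - a) * α.real Set.univ)) := by
          rw [ENNReal.inv_mul_cancel hα hMtop, one_mul, ENNReal.ofReal_mul (by positivity),
            ENNReal.ofReal_mul (by linarith), Measure.real, ENNReal.ofReal_toReal hMtop]

end Coupling

/-- Moser coupling bound: if `−Δφ = ρ₀ − n` on the torus and `n ≥ 1/2`, then
`W_p^p(ρ₀, n) ≤ 2^{p−1} p^p ∫ |∇φ|^p`. -/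
theorem wasserstein_poisson_bound (d : ℕ) (R p n : ℝ) (hR : 0 < R) (hp : 1 ≤ p)
    (hn : 1 / 2 ≤ n) (ρ₀ φ : EuclideanSpace ℝ (Fin d) → ℝ)
    (hρ₀smooth : ContDiff ℝ (⊤ : ℕ∞) ρ₀) (hρ₀nonneg : ∀ x, 0 ≤ ρ₀ x)
    (hρ₀per : ∀ x i, ρ₀ (x + R • EuclideanSpace.single i 1) = ρ₀ x)
    (hmean : (∫ x in torusCube d R, ρ₀ x) = n * R ^ d)
    (hφsmooth : ContDiff ℝ (⊤ : ℕ∞) φ)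
    (hφper : ∀ x i, φ (x + R • EuclideanSpace.single i 1) = φ x)
    (hPDE : ∀ x, -(lap d φ x) = ρ₀ x - n) :
    WpTorusPow d R p
        ((volume.restrict (torusCube d R)).withDensity (fun x => ENNReal.ofReal (ρ₀ x)))
        ((ENNReal.ofReal n) • volume.restrict (torusCube d R))
      ≤ 2 ^ (p - 1) * p ^ p * ∫ x in torusCube d R, ‖gradient φ x‖ ^ p := by
  have hn0 : 0 < n := by linarith
  have hp0 : 0 < p := by linarith
  obtain ⟨C, hC, hQC⟩ := exists_compact_torusCube_subset d R
  have hQ := measurableSet_torusCube (d := d) (R := R)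
  set I := ∫ x in torusCube d R, ‖gradient φ x‖ ^ p with hI
  set α := (volume.restrict (torusCube d R)).withDensity fun x => ENNReal.ofReal (ρ₀ x) with hα
  set β := ENNReal.ofReal n • volume.restrict (torusCube d R) with hβ
  have hI0 : 0 ≤ I := integral_nonneg fun x => by positivity
  have hIlint : ∫⁻ x in torusCube d R, ENNReal.ofReal (‖gradient φ x‖ ^ p) = ENNReal.ofReal I := by
    refine (ofReal_integral_eq_lintegral_ofReal ?_ (ae_of_all _ fun x => by positivity)).symm
    have hcont : Continuous fun x => ‖gradient φ x‖ ^ p :=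
      (contDiff_gradient hφsmooth).continuous.norm.rpow_const fun _ => Or.inr hp0.le
    exact (hcont.continuousOn.integrableOn_compact hC).mono_set hQC
  have hαM : α Set.univ = ENNReal.ofReal (n * R ^ d) := by
    rw [hα, withDensity_apply _ MeasurableSet.univ, Measure.restrict_univ, ← hmean]
    refine (ofReal_integral_eq_lintegral_ofReal ?_ (ae_of_all _ hρ₀nonneg)).symm
    exact (hρ₀smooth.continuous.continuousOn.integrableOn_compact hC).mono_set hQC
  have hβM : β Set.univ = ENNReal.ofReal (n * R ^ d) := by
    rw [hβ, Measure.smul_apply, Measure.restrict_apply_univ, volume_torusCube, smul_eq_mul,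
      ENNReal.ofReal_mul hn0.le, ENNReal.ofReal_pow hR.le]
  have : IsFiniteMeasure α := ⟨hαM ▸ ENNReal.ofReal_lt_top⟩
  have : IsFiniteMeasure β := ⟨hβM ▸ ENNReal.ofReal_lt_top⟩
  have hα0 : α Set.univ ≠ 0 := by
    rw [hαM]
    exact (ENNReal.ofReal_pos.2 (by positivity)).ne'
  obtain ⟨D, hD⟩ := exists_pdist_le (d := d) hR
  have hbound : ∀ κ : ℝ, 1 < κ → WpTorusPow d R p α β ≤
      κ * p ^ p * n ^ (1 - p) * I + D ^ p * ((1 - κ⁻¹ * κ⁻¹) * α.real Set.univ) := by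
    intro κ hκ
    have hκ0 : 0 < κ := by linarith
    have hκ1 : κ⁻¹ < 1 := inv_lt_one_of_one_lt₀ hκ
    have hκi : 0 < κ⁻¹ := inv_pos.2 hκ0
    obtain ⟨S, hS, hmap, hcost⟩ := exists_approx_transport hR hn0 hp hρ₀smooth hρ₀nonneg hρ₀per
      hφsmooth hφper hPDE (ε := 1 - κ⁻¹) (κ := κ) (by linarith) (by linarith) hκ
    rw [restrict_withDensity hQ] at hmap hcost
    set αε := (volume.restrict (torusCube d R)).withDensity
      fun x => ENNReal.ofReal (moserDensity d n ρ₀ (1 - κ⁻¹) x) with hαε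
    have hle : ENNReal.ofReal κ⁻¹ • α ≤ αε := by
      rw [hα, hαε, ← withDensity_smul _ hρ₀smooth.continuous.measurable.ennreal_ofReal]
      refine withDensity_mono (ae_of_all _ fun x => ?_)
      rw [Pi.smul_apply, smul_eq_mul, ← ENNReal.ofReal_mul hκi.le]
      refine ENNReal.ofReal_le_ofReal ?_
      have : 0 ≤ (1 - κ⁻¹) * n := mul_nonneg (by linarith) hn0.le
      rw [moserDensity, sub_sub_cancel]
      linarith
    have hle' : ENNReal.ofReal (κ⁻¹ * κ⁻¹) • α ≤ ENNReal.ofReal κ⁻¹ • αε := by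
      rw [ENNReal.ofReal_mul hκi.le, ← smul_smul]
      gcongr
    refine WpTorusPow_le_of_map_le hp0.le hα0 (hαM.trans hβM.symm) (by positivity)
      (mul_le_one₀ hκ1.le hκi.le hκ1.le) hS ?_ hD (by positivity) ?_
    · refine (Measure.map_mono hle' hS).trans ?_
      rw [Measure.map_smul]
      calc _ ≤ ENNReal.ofReal κ⁻¹ • ENNReal.ofReal κ • β := by gcongr
        _ = β := by
          rw [smul_smul, ← ENNReal.ofReal_mul hκi.le, inv_mul_cancel₀ hκ0.ne', ENNReal.ofReal_one,
            one_smul]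
    · rw [ENNReal.ofReal_mul (p := κ * p ^ p * n ^ (1 - p)) (by positivity), ← hIlint]
      refine (lintegral_mono' (hle'.trans ?_) le_rfl).trans hcost
      calc ENNReal.ofReal κ⁻¹ • αε ≤ (1 : ENNReal) • αε := by
            gcongr
            exact ENNReal.ofReal_le_one.2 hκ1.le
        _ = αε := one_smul _ _
  have hlim : WpTorusPow d R p α β ≤ p ^ p * n ^ (1 - p) * I := by
    have hc : ContinuousAt (fun κ : ℝ => κ * p ^ p * n ^ (1 - p) * I +
        D ^ p * ((1 - κ⁻¹ * κ⁻¹) * α.real Set.univ)) 1 := by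
      have : ContinuousAt (fun κ : ℝ => κ⁻¹) 1 := continuousAt_inv₀ one_ne_zero
      fun_prop
    have ht := hc.tendsto.mono_left (nhdsWithin_le_nhds (s := Set.Ioi 1))
    have h := ge_of_tendsto ht (Filter.eventually_of_mem self_mem_nhdsWithin hbound)
    simpa using h
  refine hlim.trans ?_
  rw [mul_comm (p ^ p)]
  gcongr
  calc n ^ (1 - p) ≤ (1 / 2) ^ (1 - p) :=
        Real.rpow_le_rpow_of_nonpos (by norm_num) hn (by linarith)
    _ = 2 ^ (p - 1) := by
        rw [one_div, Real.inv_rpow (by norm_num), ← Real.rpow_neg (by norm_num), neg_sub]
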